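/- The infinite binary word q = g(p) has factor complexity ρ_q(n) = 2n for all n ≥ 1, and its critical exponent equals 5/2; moreover this critical exponent is attained by a factor of q. -/

import Mathlib

/-- The finite block of length `n` occurring at position `i` in the infinite word `x`. -/
def FactorAt {A : Type*} (x : ℕ → A) (i n : ℕ) : List A :=
  (List.range n).map fun t => x (i + t)

/-- `w` is a (finite) factor of the infinite word `x`. -/
def IsFactor {A : Type*} (x : ℕ → A) (w : List A) : Prop :=
  ∃ i, w = FactorAt x i w.length

/-- Factor complexity of an infinite word: the number of distinct factors of length `n`. -/
noncomputable def complexity {A : Type*} (x : ℕ → A) (n : ℕ) : ℕ :=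
  Set.ncard {w : List A | w.length = n ∧ IsFactor x w}

/-- Factor complexity of a finite word: the number of distinct factors of length `n`. -/
noncomputable def complexityF {A : Type*} (z : List A) (n : ℕ) : ℕ :=
  Set.ncard {w : List A | w.length = n ∧ w <:+: z}

/-- `p` is a period of the finite word `y`:  `1 ≤ p ≤ |y|` and `y[j] = y[j+p]`
for all `0 ≤ j < |y| - p`. -/
def HasPeriod {A : Type*} [Inhabited A] (y : List A) (p : ℕ) : Prop :=
  1 ≤ p ∧ p ≤ y.length ∧ ∀ j, j + p < y.length → y.getD j default = y.getD (j + p) default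

/-- The smallest period of a finite word. -/
noncomputable def minPeriod {A : Type*} [Inhabited A] (y : List A) : ℕ :=
  sInf {p | HasPeriod y p}

/-- The exponent of a finite word: its length divided by its smallest period. -/
noncomputable def exponent {A : Type*} [Inhabited A] (y : List A) : ℚ :=
  (y.length : ℚ) / (minPeriod y : ℚ)

/-- The critical exponent of an infinite word: the supremum of the exponents of its
nonempty finite factors. -/
noncomputable def criticalExponent {A : Type*} [Inhabited A] (x : ℕ → A) : ENNReal :=
  sSup {e : ENNReal | ∃ w, IsFactor x w ∧ w ≠ [] ∧ e = ENNReal.ofReal ((exponent w : ℚ) : ℝ)}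

/-- The image of a finite word under a morphism given by its action on letters. -/
def mapWord {k : ℕ} {A : Type*} (σ : Fin k → List A) (w : List (Fin k)) : List A :=
  (w.map σ).flatten

/-- The image of an infinite word under a (nonerasing) morphism given by its action on
letters: the `n`-th letter of the concatenation `σ (x 0) ++ σ (x 1) ++ ⋯`. -/
def applyMorph {k : ℕ} {A : Type*} [Inhabited A] (σ : Fin k → List A) (x : ℕ → Fin k) :
    ℕ → A :=
  fun n => (((List.range (n + 1)).map fun i => σ (x i)).flatten).getD n default

/-- The morphism `h` with `h(0) = 01`, `h(1) = 21`, `h(2) = 0`. -/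
def hm : Fin 3 → List (Fin 3) := ![[0, 1], [2, 1], [0]]

/-- The morphism `g` with `g(0) = 011`, `g(1) = 0`, `g(2) = 01`. -/
def gm : Fin 3 → List (Fin 2) := ![[0, 1, 1], [0], [0, 1]]

/-- The abelian complexity of a binary infinite word at `n`: the number of distinct
values taken by the count of `0`'s among its length-`n` factors. -/
noncomputable def abelianComplexity (x : ℕ → Fin 2) (n : ℕ) : ℕ :=
  Set.ncard {z : ℕ | ∃ i, z = (FactorAt x i n).count 0}

/-- The position at which the image of the `n`-th letter of `x` starts in `σ (x)`. -/
def blockStart {k : ℕ} {A : Type*} (σ : Fin k → List A) (x : ℕ → Fin k) (n : ℕ) : ℕ :=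
  ∑ i ∈ Finset.range n, (σ (x i)).length

section Blocks

variable {k : ℕ} {A : Type*} {σ : Fin k → List A} {x : ℕ → Fin k}

theorem blockStart_succ (n : ℕ) :
    blockStart σ x (n + 1) = blockStart σ x n + (σ (x n)).length :=
  Finset.sum_range_succ _ _

theorem length_flatten_range (n : ℕ) :
    (((List.range n).map fun i => σ (x i)).flatten).length = blockStart σ x n := by
  induction n with
  | zero => simp [blockStart]
  | succ n ih => simp [List.range_succ, blockStart_succ, ← ih]

theorem le_blockStart (hσ : ∀ c, σ c ≠ []) (n : ℕ) : n ≤ blockStart σ x n := by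
  induction n with
  | zero => simp
  | succ n ih =>
    have := List.length_pos_iff.2 (hσ (x n))
    rw [blockStart_succ]; omega

theorem applyMorph_blockStart_add [Inhabited A] (hσ : ∀ c, σ c ≠ []) (n t : ℕ)
    (ht : t < (σ (x n)).length) :
    applyMorph σ x (blockStart σ x n + t) = (σ (x n)).getD t default := by
  obtain ⟨d, hd⟩ : ∃ d, blockStart σ x n + t + 1 = n + 1 + d :=
    ⟨_, (Nat.add_sub_cancel' (by have := le_blockStart (x := x) hσ n; omega)).symm⟩
  rw [applyMorph, hd, List.range_add, List.map_append, List.flatten_append, List.range_succ,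
    List.map_append, List.flatten_append, List.append_assoc,
    List.getD_append_right _ _ _ _ (by rw [length_flatten_range]; omega), length_flatten_range,
    Nat.add_sub_cancel_left]
  simp only [List.map_cons, List.map_nil, List.flatten_cons, List.flatten_nil, List.append_nil]
  rw [List.getD_append _ _ _ _ ht]

theorem exists_blockStart_add (hσ : ∀ c, σ c ≠ []) (m : ℕ) :
    ∃ n t, t < (σ (x n)).length ∧ m = blockStart σ x n + t := by
  induction m with
  | zero => exact ⟨0, 0, List.length_pos_iff.2 (hσ _), by simp [blockStart]⟩
  | succ m ih =>
    obtain ⟨n, t, ht, rfl⟩ := ih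
    by_cases h : t + 1 < (σ (x n)).length
    · exact ⟨n, t + 1, h, rfl⟩
    · exact ⟨n + 1, 0, List.length_pos_iff.2 (hσ _), by rw [blockStart_succ]; omega⟩

end Blocks

/-- The block structure of a fixed point `p` of `hm`; `H n` is the start of the `n`-th block. -/
structure IsHBlock (p : ℕ → Fin 3) (H : ℕ → ℕ) : Prop where
  zero : p 0 = 0
  start : H 0 = 0
  succ : ∀ n, H (n + 1) = H n + if p n = 2 then 1 else 2
  fst : ∀ n, p (H n) = if p n = 1 then 2 else 0
  snd : ∀ n, p n ≠ 2 → p (H n + 1) = 1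
  cover : ∀ m, ∃ n, m = H n ∨ p n ≠ 2 ∧ m = H n + 1

/-- The block structure of `q = gm (p)`; `G n` is the start of the `n`-th block. -/
structure IsGBlock (p : ℕ → Fin 3) (q : ℕ → Fin 2) (G : ℕ → ℕ) : Prop where
  start : G 0 = 0
  succ : ∀ n, G (n + 1) = G n + if p n = 0 then 3 else if p n = 1 then 1 else 2
  fst : ∀ n, q (G n) = 0
  snd : ∀ n, p n ≠ 1 → q (G n + 1) = 1
  trd : ∀ n, p n = 0 → q (G n + 2) = 1
  cover : ∀ m, ∃ n, m = G n ∨ p n ≠ 1 ∧ m = G n + 1 ∨ p n = 0 ∧ m = G n + 2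

theorem fin_three_cases (c : Fin 3) : c = 0 ∨ c = 1 ∨ c = 2 := by
  revert c; decide

theorem isHBlock {p : ℕ → Fin 3} (hp0 : p 0 = 0) (hpfix : applyMorph hm p = p) :
    IsHBlock p (blockStart hm p) := by
  have hσ : ∀ c, hm c ≠ [] := by decide
  have key := fun n t ht => applyMorph_blockStart_add (x := p) hσ n t ht
  rw [hpfix] at key
  refine ⟨hp0, by simp [blockStart], fun n => ?_, fun n => ?_, fun n hn => ?_, fun m => ?_⟩
  · rw [blockStart_succ]
    obtain h | h | h := fin_three_cases (p n) <;> simp [h, hm]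
  · have := key n 0 (List.length_pos_iff.2 (hσ _))
    rw [Nat.add_zero] at this
    rw [this]
    obtain h | h | h := fin_three_cases (p n) <;> simp [h, hm]
  · have := key n 1
    obtain h | h | h := fin_three_cases (p n) <;> simp_all [hm]
  · obtain ⟨n, t, ht, rfl⟩ := exists_blockStart_add (x := p) hσ m
    refine ⟨n, ?_⟩
    obtain h | h | h := fin_three_cases (p n) <;> simp [h, hm] at ht ⊢ <;> omega

theorem isGBlock (p : ℕ → Fin 3) : IsGBlock p (applyMorph gm p) (blockStart gm p) := by
  have hσ : ∀ c, gm c ≠ [] := by decide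
  have key := fun n t ht => applyMorph_blockStart_add (x := p) hσ n t ht
  refine ⟨by simp [blockStart], fun n => ?_, fun n => ?_, fun n hn => ?_, fun n hn => ?_,
    fun m => ?_⟩
  · rw [blockStart_succ]
    obtain h | h | h := fin_three_cases (p n) <;> simp [h, gm]
  · have := key n 0 (List.length_pos_iff.2 (hσ _))
    rw [Nat.add_zero] at this
    rw [this]
    obtain h | h | h := fin_three_cases (p n) <;> simp [h, gm]
  · have := key n 1
    obtain h | h | h := fin_three_cases (p n) <;> simp_all [gm]
  · have := key n 2
    simp_all [gm]
  · obtain ⟨n, t, ht, rfl⟩ := exists_blockStart_add (x := p) hσ m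
    refine ⟨n, ?_⟩
    obtain h | h | h := fin_three_cases (p n) <;> simp [h, gm] at ht ⊢ <;> omega

/-- The windows of length `n` of `x` starting at `i` and at `j` coincide. -/
def Agree {A : Type*} (x : ℕ → A) (i j n : ℕ) : Prop :=
  ∀ t < n, x (i + t) = x (j + t)

namespace Agree

variable {A : Type*} {x : ℕ → A} {i j k n m : ℕ}

theorem symm (h : Agree x i j n) : Agree x j i n := fun t ht => (h t ht).symm

theorem trans (h : Agree x i j n) (h' : Agree x j k n) : Agree x i k n :=
  fun t ht => (h t ht).trans (h' t ht)

theorem mono (h : Agree x i j n) (hm : m ≤ n) : Agree x i j m :=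
  fun t ht => h t (ht.trans_le hm)

theorem eq_of_add (h : Agree x i j n) {a b : ℕ} (t : ℕ) (ht : t < n) (ha : a = i + t)
    (hb : b = j + t) : x a = x b := by
  rw [ha, hb, h t ht]

theorem shift (h : Agree x i j n) (d : ℕ) (hm : m + d ≤ n) : Agree x (i + d) (j + d) m :=
  fun t ht => h.eq_of_add (d + t) (by omega) (by omega) (by omega)

theorem succ (h : Agree x i j n) (hn : x (i + n) = x (j + n)) : Agree x i j (n + 1) :=
  fun t ht => by
    obtain ht | rfl := Nat.lt_succ_iff_lt_or_eq.1 ht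
    · exact h t ht
    · exact hn

theorem cons (h : Agree x (i + 1) (j + 1) n) (hn : x i = x j) : Agree x i j (n + 1) :=
  fun t ht => by
    obtain _ | t := t
    · exact hn
    · exact h.eq_of_add t (by omega) (by omega) (by omega)

end Agree

namespace IsHBlock

variable {p : ℕ → Fin 3} {H : ℕ → ℕ}

theorem strictMono (hH : IsHBlock p H) : StrictMono H :=
  strictMono_nat_of_lt_succ fun n => by have := hH.succ n; split_ifs at this <;> omega

theorem fst_ne_one (hH : IsHBlock p H) (n : ℕ) : p (H n) ≠ 1 := by
  rw [hH.fst]; split_ifs <;> decide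

theorem exists_of_ne_one (hH : IsHBlock p H) {m : ℕ} (hm : p m ≠ 1) : ∃ n, H n = m := by
  obtain ⟨n, rfl | ⟨h, rfl⟩⟩ := hH.cover m
  · exact ⟨n, rfl⟩
  · exact absurd (hH.snd n h) hm

theorem exists_of_eq_one (hH : IsHBlock p H) {m : ℕ} (hm : p m = 1) :
    ∃ n, p n ≠ 2 ∧ m = H n + 1 := by
  obtain ⟨n, rfl | h⟩ := hH.cover m
  · exact absurd hm (hH.fst_ne_one n)
  · exact ⟨n, h⟩

theorem succ_of_eq_two (hH : IsHBlock p H) {n : ℕ} (h : p n = 2) : H (n + 1) = H n + 1 := by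
  simp [hH.succ, h]

theorem succ_of_ne_two (hH : IsHBlock p H) {n : ℕ} (h : p n ≠ 2) : H (n + 1) = H n + 2 := by
  simp [hH.succ, h]

theorem one (hH : IsHBlock p H) : H 1 = 2 := by
  have := hH.succ_of_ne_two (n := 0) (by simp [hH.zero])
  rwa [hH.start] at this

theorem lt_self (hH : IsHBlock p H) {n : ℕ} (hn : 1 ≤ n) : n < H n := by
  induction n, hn using Nat.le_induction with
  | base => simp [hH.one]
  | succ n _ ih => have := hH.strictMono (lt_add_one n); omega

theorem add_one_lt_self (hH : IsHBlock p H) {n : ℕ} (hn : 2 ≤ n) : n + 1 < H n := by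
  induction n, hn using Nat.le_induction with
  | base =>
    have h1 : p 1 = 1 := by simpa [hH.start] using hH.snd 0 (by simp [hH.zero])
    have := hH.succ_of_ne_two (n := 1) (by simp [h1])
    rw [hH.one] at this
    simp [this]
  | succ n _ ih => have := hH.strictMono (lt_add_one n); omega

/-- A letter `2` is followed by `1`, a letter `0` by `1` or `2`, a letter `1` by `0` or `2`. -/
theorem next (hH : IsHBlock p H) (n : ℕ) :
    (p n = 0 → p (n + 1) ≠ 0) ∧ (p n = 1 → p (n + 1) ≠ 1) ∧ (p n = 2 → p (n + 1) = 1) := by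
  induction n using Nat.strong_induction_on with
  | _ n ih =>
  obtain ⟨a, rfl | ⟨h, rfl⟩⟩ := hH.cover n
  · by_cases h : p a = 2
    · have ha : a ≠ 0 := by rintro rfl; simp [hH.zero] at h
      have h1 := (ih a (hH.lt_self (by omega))).2.2 h
      have h2 := hH.fst (a + 1)
      rw [hH.succ_of_eq_two h] at h2
      simp [hH.fst a, h, h2, h1]
    · have := hH.snd a h
      have := hH.fst_ne_one a
      simp_all
  · have h2 := hH.fst_ne_one (a + 1)
    rw [hH.succ_of_ne_two h] at h2
    simp [hH.snd a h]
    exact h2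

theorem agree_of_agree (hH : IsHBlock p H) {a b m n : ℕ} (h : Agree p (H a) (H b) n)
    (ha : H (a + m) = H a + n) (hb : p (H b + n) ≠ 1) :
    Agree p a b m ∧ H (b + m) = H b + n := by
  induction m generalizing n with
  | zero =>
    obtain rfl : n = 0 := by simpa using ha.symm
    exact ⟨fun t ht => by omega, rfl⟩
  | succ m ih =>
    have hlt := hH.strictMono (lt_add_one (a + m))
    obtain ⟨d, hd⟩ : ∃ d, H (a + m) = H a + d :=
      Nat.exists_eq_add_of_le (hH.strictMono.monotone (by omega))
    have hdn : d < n := by rw [← add_assoc] at ha; omega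
    have e0 := h d hdn
    have hne := hH.fst_ne_one (a + m)
    obtain ⟨h1, h2⟩ := ih (h.mono hdn.le) hd (by rw [← e0, ← hd]; exact hne)
    have f1 := hH.fst (a + m)
    have f2 := hH.fst (b + m)
    rw [hd] at f1
    rw [h2, ← e0, f1] at f2
    have s1 := hH.succ (a + m)
    have s2 := hH.succ (b + m)
    have t1 := hH.snd (a + m)
    have t2 := hH.snd (b + m)
    rw [hd, add_assoc] at t1
    rw [h2, add_assoc] at t2
    have v1 := hH.fst_ne_one (a + m + 1)
    have v2 := hH.fst_ne_one (b + m + 1)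
    have e1 := h (d + 1)
    have key : p (a + m) = p (b + m) := by
      clear ih h hlt
      obtain c1 | c1 | c1 := fin_three_cases (p (a + m)) <;>
      obtain c2 | c2 | c2 := fin_three_cases (p (b + m)) <;>
        simp only [c1, c2] at * <;> grind
    refine ⟨h1.succ key, ?_⟩
    rw [← key] at s2
    rw [← add_assoc] at ha ⊢
    omega

end IsHBlock

namespace IsGBlock

variable {p : ℕ → Fin 3} {q : ℕ → Fin 2} {G : ℕ → ℕ}

theorem strictMono (hG : IsGBlock p q G) : StrictMono G :=
  strictMono_nat_of_lt_succ fun n => by have := hG.succ n; split_ifs at this <;> omega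

theorem agree_of_agree (hG : IsGBlock p q G) {a b m n : ℕ} (h : Agree q (G a) (G b) n)
    (ha : G (a + m) = G a + n) (hb : q (G b + n) = 0) :
    Agree p a b m ∧ G (b + m) = G b + n := by
  induction m generalizing n with
  | zero =>
    obtain rfl : n = 0 := by simpa using ha.symm
    exact ⟨fun t ht => by omega, rfl⟩
  | succ m ih =>
    obtain ⟨d, hd⟩ : ∃ d, G (a + m) = G a + d :=
      Nat.exists_eq_add_of_le (hG.strictMono.monotone (by omega))
    have s1 := hG.succ (a + m)
    have hdn : d < n := by rw [← add_assoc] at ha; split_ifs at s1 <;> omega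
    have e0 := h d hdn
    obtain ⟨h1, h2⟩ := ih (h.mono hdn.le) hd (by rw [← e0, ← hd]; exact hG.fst _)
    have s2 := hG.succ (b + m)
    have t1 := hG.snd (a + m)
    have t2 := hG.snd (b + m)
    have u1 := hG.trd (a + m)
    have u2 := hG.trd (b + m)
    have v1 := hG.fst (a + m + 1)
    have v2 := hG.fst (b + m + 1)
    rw [hd, add_assoc] at t1 u1
    rw [h2, add_assoc] at t2 u2
    have e1 := h (d + 1)
    have e2 := h (d + 2)
    have key : p (a + m) = p (b + m) := by
      obtain c1 | c1 | c1 := fin_three_cases (p (a + m)) <;>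
      obtain c2 | c2 | c2 := fin_three_cases (p (b + m)) <;>
        simp only [c1, c2] at * <;> grind
    refine ⟨h1.succ key, ?_⟩
    rw [← key] at s2
    rw [← add_assoc] at ha ⊢
    omega

end IsGBlock

/-- Some word `w` of length `n` has two distinct left extensions `a, b` and two distinct right
extensions `c, d` such that `awc, awd, bwc, bwd` all occur in `x`. -/
def HasStrong {A : Type*} (x : ℕ → A) (n : ℕ) : Prop :=
  ∃ i j k l, x i = x j ∧ x k = x l ∧ x i ≠ x k ∧
    Agree x (i + 1) (j + 1) n ∧ Agree x (i + 1) (k + 1) n ∧ Agree x (i + 1) (l + 1) n ∧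
    x (i + 1 + n) = x (k + 1 + n) ∧ x (j + 1 + n) = x (l + 1 + n) ∧
    x (i + 1 + n) ≠ x (j + 1 + n)

theorem Agree.last {A : Type*} {x : ℕ → A} {i j n : ℕ} (h : Agree x (i + 1) (j + 1) n)
    (h0 : x i = x j) : x (i + n) = x (j + n) :=
  h.cons h0 n (Nat.lt_succ_self n)

namespace IsHBlock

variable {p : ℕ → Fin 3} {H : ℕ → ℕ}

theorem add_le (hH : IsHBlock p H) (a m : ℕ) : H a + m ≤ H (a + m) := by
  induction m with
  | zero => exact le_rfl
  | succ m ih => have := hH.strictMono (lt_add_one (a + m)); rw [← add_assoc a]; omega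

theorem exists_left_of_one (hH : IsHBlock p H) {x : ℕ} (hx : p (x + 1) = 1) :
    ∃ a, H (a + 1) = x + 2 ∧ p a = if p x = 0 then 0 else 1 := by
  obtain ⟨a, ha, hxa⟩ := hH.exists_of_eq_one hx
  obtain rfl : x = H a := by omega
  refine ⟨a, hH.succ_of_ne_two ha, ?_⟩
  rw [hH.fst]
  have := fin_three_cases (p a)
  grind

theorem exists_left_of_two (hH : IsHBlock p H) {x : ℕ} (hx : p (x + 1) = 2) :
    ∃ a, H (a + 1) = x + 1 ∧ p a = if p x = 0 then 2 else 0 := by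
  obtain ⟨w, hw⟩ := hH.exists_of_ne_one (m := x + 1) (by rw [hx]; decide)
  have hw0 : w ≠ 0 := by rintro rfl; rw [hH.start] at hw; omega
  obtain ⟨a, rfl⟩ := Nat.exists_eq_add_of_le' (Nat.one_le_iff_ne_zero.2 hw0)
  have h1 : p (a + 1) = 1 := by
    have := hH.fst (a + 1)
    rw [hw, hx] at this
    split_ifs at this with h
    · exact h
    · exact absurd this (by decide)
  refine ⟨a, hw, ?_⟩
  by_cases h2 : p a = 2
  · rw [hH.succ_of_eq_two h2] at hw
    obtain rfl : x = H a := by omega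
    simp [hH.fst, h2]
  · rw [hH.succ_of_ne_two h2] at hw
    obtain rfl : x = H a + 1 := by omega
    have := (hH.next a).2.1
    have := fin_three_cases (p a)
    simp only [hH.snd a h2]
    grind

theorem exists_right_of_zero (hH : IsHBlock p H) {w : ℕ} (hw : p (H w) = 0) :
    p w = if p (H w + 1) = 1 then 0 else 2 := by
  have h1 := hH.fst w
  have h2 := hH.snd w
  have h3 := hH.fst_ne_one (w + 1)
  have h4 := hH.succ w
  obtain h | h | h := fin_three_cases (p w) <;> simp only [h] at * <;> grind

theorem not_hasStrong (hH : IsHBlock p H) (n : ℕ) : ¬ HasStrong p n := by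
  induction n using Nat.strong_induction_on with
  | _ n ih =>
  rintro ⟨i, j, k, l, hij, hkl, hik, aij, aik, ail, cik, cjl, cij⟩
  obtain rfl | hn := Nat.eq_zero_or_pos n
  · have := hH.next i
    have := hH.next j
    have := hH.next k
    have := hH.next l
    have := fin_three_cases (p i)
    have := fin_three_cases (p k)
    have := fin_three_cases (p (i + 1))
    have := fin_three_cases (p (j + 1))
    grind
  obtain ⟨s, φ, hs, hφ, left⟩ : ∃ s, ∃ φ : Fin 3 → Fin 3,
      (s = 0 ∧ p (i + 1) = 2 ∨ s = 1 ∧ p (i + 1) = 1) ∧ φ (p i) ≠ φ (p k) ∧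
      ∀ x, p (x + 1) = p (i + 1) → ∃ a, H (a + 1) = x + 1 + s ∧ p a = φ (p x) := by
    have ni := hH.next i
    have nk := hH.next k
    have ek : p (i + 1) = p (k + 1) := aik 0 hn
    have ci := fin_three_cases (p i)
    have ck := fin_three_cases (p k)
    obtain h | h | h := fin_three_cases (p (i + 1))
    · grind
    · refine ⟨1, fun c => if c = 0 then 0 else 1, Or.inr ⟨rfl, h⟩, by grind, fun x hx => ?_⟩
      exact hH.exists_left_of_one (hx.trans h)
    · refine ⟨0, fun c => if c = 0 then 2 else 0, Or.inl ⟨rfl, h⟩, by grind, fun x hx => ?_⟩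
      exact hH.exists_left_of_two (hx.trans h)
  obtain ⟨a, ha, pa⟩ := left i rfl
  obtain ⟨b, hb, pb⟩ := left j (aij 0 hn).symm
  obtain ⟨c, hc, pc⟩ := left k (aik 0 hn).symm
  obtain ⟨d, hd, pd⟩ := left l (ail 0 hn).symm
  have lij : p (j + n) = p (i + n) := (aij.last hij).symm
  have lik : p (k + n) = p (i + n) :=
    (aik.eq_of_add (n - 1) (by omega) (by omega) (by omega)).symm
  have lil : p (l + n) = p (i + n) :=
    (ail.eq_of_add (n - 1) (by omega) (by omega) (by omega)).symm
  rw [add_right_comm] at cik cij cjl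
  rw [add_right_comm _ 1 n] at cik cij cjl
  have ni := hH.next (i + n)
  have nj := hH.next (j + n)
  have nk := hH.next (k + n)
  have nl := hH.next (l + n)
  obtain ⟨r, hr⟩ : ∃ r, r = 0 ∧ p (i + n) = 1 ∨ r = 1 ∧ p (i + n) = 0 := by
    obtain h | h | h := fin_three_cases (p (i + n))
    · exact ⟨1, Or.inr ⟨rfl, h⟩⟩
    · exact ⟨0, Or.inl ⟨rfl, h⟩⟩
    · grind
  have hsr : s + r ≤ n := by
    by_contra hlt
    obtain rfl : n = 1 := by omega
    grind
  obtain ⟨N, hN⟩ : ∃ N, N + s + r = n := ⟨n - s - r, by omega⟩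
  have cut : ∀ x, p (x + n) = p (i + n) → p (x + 1 + s + N) ≠ 1 := by
    intro x hx
    obtain ⟨rfl, h⟩ | ⟨rfl, h⟩ := hr
    · rw [show x + 1 + s + N = x + n + 1 by omega]
      exact (hH.next (x + n)).2.1 (hx.trans h)
    · rw [show x + 1 + s + N = x + n by omega, hx, h]
      decide
  obtain ⟨w, hw⟩ := hH.exists_of_ne_one (cut i rfl)
  obtain ⟨m, rfl⟩ : ∃ m, w = a + 1 + m :=
    Nat.exists_eq_add_of_le (hH.strictMono.le_iff_le.1 (by omega))
  rw [← ha] at hw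
  have sync : ∀ x y, H (y + 1) = x + 1 + s → Agree p (i + 1) (x + 1) n →
      p (x + n) = p (i + n) → Agree p (a + 1) (y + 1) m ∧ H (y + 1 + m) = x + 1 + s + N := by
    intro x y hy hag hx
    rw [← hy]
    refine hH.agree_of_agree ?_ hw (by rw [hy]; exact cut x hx)
    rw [ha, hy]
    exact hag.shift s (by omega)
  obtain ⟨sj, hj⟩ := sync j b hb aij lij
  obtain ⟨sk, hk⟩ := sync k c hc aik lik
  obtain ⟨sl, hl⟩ := sync l d hd ail lil
  rw [ha] at hw
  have hmn : m < n := by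
    obtain rfl | hm := Nat.eq_zero_or_pos m
    · exact hn
    have h1 := hH.add_le (a + 1) m
    obtain ⟨hs0, hs⟩ | ⟨hs0, hs⟩ := hs
    · have h2 := hH.add_le (a + 1 + 1) (m - 1)
      rw [show a + 1 + 1 + (m - 1) = a + 1 + m by omega] at h2
      have h3 := hH.fst (a + 1)
      rw [ha, hs0, add_zero, hs] at h3
      have h4 := hH.succ (a + 1)
      split_ifs at h3 h4 with h5 h6 <;> omega
    · omega
  have qab : p (a + m) = p (b + m) := sj.last (by rw [pa, pb, hij])
  have qcd : p (c + m) = p (d + m) :=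
    (sk.symm.trans sl).last (by rw [pc, pd, hkl])
  have na := hH.next (a + m)
  have nb := hH.next (b + m)
  have nc := hH.next (c + m)
  have nd := hH.next (d + m)
  rw [add_right_comm] at na nb nc nd
  have right : p (a + 1 + m) = p (c + 1 + m) ∧ p (b + 1 + m) = p (d + 1 + m) ∧
      p (a + 1 + m) ≠ p (b + 1 + m) := by
    obtain ⟨rfl, h⟩ | ⟨rfl, h⟩ := hr
    · have f1 := hH.fst (a + 1 + m)
      have f2 := hH.fst (b + 1 + m)
      have f3 := hH.fst (c + 1 + m)
      have f4 := hH.fst (d + 1 + m)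
      rw [hw, show i + 1 + s + N = i + n + 1 by omega] at f1
      rw [hj, show j + 1 + s + N = j + n + 1 by omega] at f2
      rw [hk, show k + 1 + s + N = k + n + 1 by omega] at f3
      rw [hl, show l + 1 + s + N = l + n + 1 by omega] at f4
      have := fin_three_cases (p (a + m))
      have := fin_three_cases (p (c + m))
      have := fin_three_cases (p (a + 1 + m))
      have := fin_three_cases (p (b + 1 + m))
      have := fin_three_cases (p (c + 1 + m))
      have := fin_three_cases (p (d + 1 + m))
      clear ih left sync cut sj sk sl aij aik ail
      grind
    · have f1 := hH.exists_right_of_zero (w := a + 1 + m)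
      have f2 := hH.exists_right_of_zero (w := b + 1 + m)
      have f3 := hH.exists_right_of_zero (w := c + 1 + m)
      have f4 := hH.exists_right_of_zero (w := d + 1 + m)
      rw [hw, show i + 1 + s + N = i + n by omega] at f1
      rw [hj, show j + 1 + s + N = j + n by omega] at f2
      rw [hk, show k + 1 + s + N = k + n by omega] at f3
      rw [hl, show l + 1 + s + N = l + n by omega] at f4
      have := fin_three_cases (p (i + n + 1))
      have := fin_three_cases (p (j + n + 1))
      clear ih left sync cut sj sk sl aij aik ail
      grind
  exact ih m hmn ⟨a, b, c, d, by rw [pa, pb, hij], by rw [pc, pd, hkl], by rwa [pa, pc], sj, sk,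
    sl, right⟩

end IsHBlock

namespace IsGBlock

variable {p : ℕ → Fin 3} {q : ℕ → Fin 2} {G H : ℕ → ℕ}

theorem exists_of_zero (hG : IsGBlock p q G) {m : ℕ} (hm : q m = 0) : ∃ n, G n = m := by
  obtain ⟨n, rfl | ⟨h, rfl⟩ | ⟨h, rfl⟩⟩ := hG.cover m
  · exact ⟨n, rfl⟩
  · rw [hG.snd n h] at hm; exact absurd hm (by decide)
  · rw [hG.trd n h] at hm; exact absurd hm (by decide)

/-- The block starting at `G n` is read off from the two letters after its initial `0`. -/
theorem read (hG : IsGBlock p q G) (n : ℕ) :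
    (q (G n + 1) = 0 ∧ p n = 1 ∧ G (n + 1) = G n + 1) ∨
    (q (G n + 1) = 1 ∧ q (G n + 2) = 0 ∧ p n = 2 ∧ G (n + 1) = G n + 2) ∨
    (q (G n + 1) = 1 ∧ q (G n + 2) = 1 ∧ q (G n + 3) = 0 ∧ p n = 0 ∧ G (n + 1) = G n + 3) := by
  have h0 := hG.succ n
  have h1 := hG.fst (n + 1)
  obtain h | h | h := fin_three_cases (p n) <;> simp only [h] at h0 <;>
    simp at h0 <;> rw [h0] at h1
  · exact Or.inr (Or.inr ⟨hG.snd n (by simp [h]), hG.trd n h, h1, h, h0⟩)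
  · exact Or.inl ⟨h1, h, h0⟩
  · exact Or.inr (Or.inl ⟨hG.snd n (by simp [h]), h1, h, h0⟩)

theorem exists_left_of_zero (hG : IsGBlock p q G) {x : ℕ} (hx : q (x + 1) = 0) :
    ∃ a, G (a + 1) = x + 1 ∧ (q x = 0 ∧ p a = 1 ∨
      q x = 1 ∧ x ≠ 0 ∧ q (x - 1) = 0 ∧ p a = 2 ∨
      q x = 1 ∧ x ≠ 0 ∧ q (x - 1) = 1 ∧ p a = 0) := by
  obtain ⟨w, hw⟩ := hG.exists_of_zero hx
  have hw0 : w ≠ 0 := by rintro rfl; rw [hG.start] at hw; omega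
  obtain ⟨a, rfl⟩ := Nat.exists_eq_add_of_le' (Nat.one_le_iff_ne_zero.2 hw0)
  refine ⟨a, hw, ?_⟩
  have h0 := hG.fst a
  obtain ⟨h1, h2, h3⟩ | ⟨h1, h2, h3, h4⟩ | ⟨h1, h2, h3, h4, h5⟩ := hG.read a
  · obtain rfl : x = G a := by omega
    exact Or.inl ⟨h0, h2⟩
  · obtain rfl : x = G a + 1 := by omega
    exact Or.inr (Or.inl ⟨h1, by omega, h0, h3⟩)
  · obtain rfl : x = G a + 2 := by omega
    exact Or.inr (Or.inr ⟨h2, by omega, h1, h4⟩)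

theorem not_one_one_one (hG : IsGBlock p q G) (x : ℕ) :
    q x = 0 ∨ q (x + 1) = 0 ∨ q (x + 2) = 0 := by
  obtain ⟨n, rfl | ⟨h, rfl⟩ | ⟨h, rfl⟩⟩ := hG.cover x
  · exact Or.inl (hG.fst n)
  all_goals
    have := hG.read n
    have := hG.fst n
    grind

theorem eq_one_of_ne {c : Fin 2} (h : c ≠ 0) : c = 1 := by
  revert c; decide

theorem not_hasStrong (hG : IsGBlock p q G) (hH : IsHBlock p H) {n : ℕ} (hn : 1 ≤ n) :
    ¬ HasStrong q n := by
  suffices key : ∀ i j k l, q i = 0 → q j = 0 → q k = 1 → q l = 1 →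
      Agree q (i + 1) (j + 1) n → Agree q (i + 1) (k + 1) n → Agree q (i + 1) (l + 1) n →
      q (i + 1 + n) = 0 → q (k + 1 + n) = 0 → q (j + 1 + n) = 1 → q (l + 1 + n) = 1 → False by
    rintro ⟨i, j, k, l, hij, hkl, hik, aij, aik, ail, cik, cjl, cij⟩
    by_cases h : q i = 0
    · have hk := eq_one_of_ne (h ▸ hik.symm)
      by_cases h' : q (i + 1 + n) = 0
      · have hj := eq_one_of_ne (h' ▸ cij.symm)
        exact key i j k l h (hij ▸ h) hk (hkl ▸ hk) aij aik ail h' (cik ▸ h') hj (cjl ▸ hj)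
      · have h1 := eq_one_of_ne h'
        have hj : q (j + 1 + n) = 0 := by_contra fun h2 => cij (h1.trans (eq_one_of_ne h2).symm)
        exact key j i l k (hij ▸ h) h (hkl ▸ hk) hk aij.symm (aij.symm.trans ail)
          (aij.symm.trans aik) hj (cjl ▸ hj) h1 (cik ▸ h1)
    · have hi := eq_one_of_ne h
      have hk : q k = 0 := by_contra fun h2 => hik (hi.trans (eq_one_of_ne h2).symm)
      by_cases h' : q (i + 1 + n) = 0
      · have hj := eq_one_of_ne (h' ▸ cij.symm)
        exact key k l i j hk (hkl ▸ hk) hi (hij ▸ hi) (aik.symm.trans ail) aik.symm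
          (aik.symm.trans aij) (cik ▸ h') h' (cjl ▸ hj) hj
      · have h1 := eq_one_of_ne h'
        have hj : q (j + 1 + n) = 0 := by_contra fun h2 => cij (h1.trans (eq_one_of_ne h2).symm)
        exact key l k j i (hkl ▸ hk) hk (hij ▸ hi) hi (ail.symm.trans aik) (ail.symm.trans aij)
          ail.symm (cjl ▸ hj) hj (cik ▸ h1) h1
  intro i j k l qi qj qk ql aij aik ail ci ck cj cl
  have lij : q (j + n) = q (i + n) := (aij.last (qi.trans qj.symm)).symm
  have lik : q (k + n) = q (i + n) :=
    (aik.eq_of_add (n - 1) (by omega) (by omega) (by omega)).symm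
  have lil : q (l + n) = q (i + n) :=
    (ail.eq_of_add (n - 1) (by omega) (by omega) (by omega)).symm
  rw [add_right_comm] at ci ck cj cl
  have hk3 := hG.not_one_one_one k
  have hl3 := hG.not_one_one_one (l + n - 1)
  have hkl3 := hG.not_one_one_one l
  rw [show l + n - 1 + 1 = l + n by omega, show l + n - 1 + 2 = l + n + 1 by omega] at hl3
  have one : ∀ {c : Fin 2}, c ≠ 0 → c = 1 := eq_one_of_ne
  have e1 : q (k + 1) = q (i + 1) := (aik 0 hn).symm
  have e1l : q (l + 1) = q (i + 1) := (ail 0 hn).symm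
  have e1j : q (j + 1) = q (i + 1) := (aij 0 hn).symm
  obtain ⟨s, hs⟩ : ∃ s, s = 0 ∧ q (i + 1) = 0 ∨
      s = 1 ∧ q (i + 1) = 1 ∧ q (i + 2) = 0 ∧ 2 ≤ n := by
    by_cases h : q (i + 1) = 0
    · exact ⟨0, Or.inl ⟨rfl, h⟩⟩
    · refine ⟨1, Or.inr ?_⟩
      have hn2 : 2 ≤ n := by
        by_contra h2
        obtain rfl : n = 1 := by omega
        have := hG.not_one_one_one l
        grind
      have e2 := aik 1 hn2
      have := one h
      refine ⟨rfl, this, ?_, hn2⟩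
      rw [add_assoc, add_assoc] at e2
      grind
  obtain ⟨r, hr⟩ : ∃ r, r = 1 ∧ q (i + n) = 0 ∨ r = 2 ∧ q (i + n) = 1 ∧ q (i + n - 1) = 0 ∧
      2 ≤ n := by
    by_cases h : q (i + n) = 0
    · exact ⟨1, Or.inl ⟨rfl, h⟩⟩
    · refine ⟨2, Or.inr ?_⟩
      have h1 := one h
      have hn2 : 2 ≤ n := by
        by_contra h2
        obtain rfl : n = 1 := by omega
        grind
      have e2 : q (i + n - 1) = q (l + n - 1) :=
        ail.eq_of_add (n - 2) (by omega) (by omega) (by omega)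
      refine ⟨rfl, h1, ?_, hn2⟩
      grind
  have hsr : s + r ≤ n := by
    by_contra hlt
    obtain ⟨rfl, h⟩ | ⟨rfl, h, h', h2⟩ := hs <;> obtain ⟨rfl, g⟩ | ⟨rfl, g, g', h3⟩ := hr
    · omega
    · omega
    · omega
    · obtain rfl : n = 2 := by omega
      grind
  obtain ⟨N, hN⟩ : ∃ N, N + s + r = n := ⟨n - s - r, by omega⟩
  have left : ∀ x, Agree q (i + 1) (x + 1) n → ∃ a, G (a + 1) = x + 1 + s ∧
      (s = 0 ∧ (q x = 0 ∧ p a = 1 ∨ q x = 1 ∧ p a ≠ 1) ∨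
      s = 1 ∧ (q x = 0 ∧ p a = 2 ∨ q x = 1 ∧ p a = 0)) := by
    intro x hx
    obtain ⟨rfl, h⟩ | ⟨rfl, h, h', h2⟩ := hs
    · obtain ⟨a, ha, h3⟩ := hG.exists_left_of_zero (x := x) ((hx 0 hn).symm.trans h)
      refine ⟨a, ha, Or.inl ⟨rfl, ?_⟩⟩
      grind
    · have e1 : q (x + 1) = 1 := (hx 0 hn).symm.trans h
      have e2 : q (x + 1 + 1) = 0 := (hx 1 h2).symm.trans h'
      obtain ⟨a, ha, h3⟩ := hG.exists_left_of_zero (x := x + 1) e2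
      refine ⟨a, ha, Or.inr ⟨rfl, ?_⟩⟩
      rw [Nat.add_sub_cancel] at h3
      grind
  obtain ⟨a, ha, pa⟩ := left i fun _ _ => rfl
  obtain ⟨b, hb, pb⟩ := left j aij
  obtain ⟨c, hc, pc⟩ := left k aik
  obtain ⟨d, hd, pd⟩ := left l ail
  have cut : ∀ x, Agree q (i + 1) (x + 1) n → q (x + 1 + s + N) = 0 := by
    intro x hx
    obtain ⟨rfl, g⟩ | ⟨rfl, g, g', h3⟩ := hr
    · rw [← hx.eq_of_add (a := i + n) (n - 1) (by omega) (by omega) (by omega), g]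
    · rw [← hx.eq_of_add (a := i + n - 1) (n - 2) (by omega) (by omega) (by omega), g']
  obtain ⟨w, hw⟩ := hG.exists_of_zero (cut i fun _ _ => rfl)
  obtain ⟨m, rfl⟩ : ∃ m, w = a + 1 + m :=
    Nat.exists_eq_add_of_le (hG.strictMono.le_iff_le.1 (by omega))
  rw [← ha] at hw
  have sync : ∀ x y, G (y + 1) = x + 1 + s → Agree q (i + 1) (x + 1) n →
      Agree p (a + 1) (y + 1) m ∧ G (y + 1 + m) = x + 1 + s + N := by
    intro x y hy hag
    rw [← hy]
    refine hG.agree_of_agree ?_ hw (by rw [hy]; exact cut x hag)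
    rw [ha, hy]
    exact hag.shift s (by omega)
  obtain ⟨sj, hj⟩ := sync j b hb aij
  obtain ⟨sk, hk⟩ := sync k c hc aik
  obtain ⟨sl, hl⟩ := sync l d hd ail
  rw [ha] at hw
  have right : ∀ x y, G y = x + 1 + s + N → q (x + n) = q (i + n) →
      (q (x + n + 1) = 0 ∧ (r = 1 ∧ p y = 1 ∨ r = 2 ∧ p y = 2) ∨
      q (x + n + 1) = 1 ∧ (r = 1 ∧ p y ≠ 1 ∨ r = 2 ∧ p y = 0)) := by
    intro x y hy hx
    have h := hG.read y
    rw [hy] at h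
    obtain ⟨rfl, g⟩ | ⟨rfl, g, g', h3⟩ := hr
    · rw [show x + 1 + s + N = x + n by omega] at h
      grind
    · rw [show x + 1 + s + N = x + n - 1 by omega, show x + n - 1 + 1 = x + n by omega,
        show x + n - 1 + 2 = x + n + 1 by omega] at h
      grind
  have ri := right i _ hw rfl
  have rj := right j _ hj lij
  have rk := right k _ hk lik
  have rl := right l _ hl lil
  have na := hH.next (a + m)
  have nb := hH.next (b + m)
  have nc := hH.next (c + m)
  have nd := hH.next (d + m)
  rw [add_right_comm] at na nb nc nd
  have goal : p a = p b ∧ p c = p d ∧ p a ≠ p c ∧ p (a + 1 + m) = p (c + 1 + m) ∧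
      p (b + 1 + m) = p (d + 1 + m) ∧ p (a + 1 + m) ≠ p (b + 1 + m) := by
    have h1 := fin_three_cases (p a)
    have h2 := fin_three_cases (p b)
    have h3 := fin_three_cases (p c)
    have h4 := fin_three_cases (p d)
    have h5 := fin_three_cases (p (a + 1 + m))
    have h6 := fin_three_cases (p (b + 1 + m))
    have h7 := fin_three_cases (p (c + 1 + m))
    have h8 := fin_three_cases (p (d + 1 + m))
    have pa' : s = 0 ∧ p a = 1 ∨ s = 1 ∧ p a = 2 := by simpa [qi] using pa
    have pb' : s = 0 ∧ p b = 1 ∨ s = 1 ∧ p b = 2 := by simpa [qj] using pb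
    have pc' : s = 0 ∧ p c ≠ 1 ∨ s = 1 ∧ p c = 0 := by simpa [qk] using pc
    have pd' : s = 0 ∧ p d ≠ 1 ∨ s = 1 ∧ p d = 0 := by simpa [ql] using pd
    rw [ci] at ri
    rw [cj] at rj
    rw [ck] at rk
    rw [cl] at rl
    have ri' : r = 1 ∧ p (a + 1 + m) = 1 ∨ r = 2 ∧ p (a + 1 + m) = 2 := by simpa using ri
    have rj' : r = 1 ∧ p (b + 1 + m) ≠ 1 ∨ r = 2 ∧ p (b + 1 + m) = 0 := by simpa using rj
    have rk' : r = 1 ∧ p (c + 1 + m) = 1 ∨ r = 2 ∧ p (c + 1 + m) = 2 := by simpa using rk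
    have rl' : r = 1 ∧ p (d + 1 + m) ≠ 1 ∨ r = 2 ∧ p (d + 1 + m) = 0 := by simpa using rl
    clear left sync right cut aij aik ail pa pb pc pd ri rj rk rl hk3 hl3 hkl3 hs hr one
      e1 e1l e1j hsr hN hn hw ha hb hc hd hj hk hl lij lik lil qi qj qk ql ci cj ck cl
    obtain rfl | hm := Nat.eq_zero_or_pos m
    · simp only [add_zero] at *
      clear sj sk sl
      grind
    · have m1 := hH.next a
      have m2 := hH.next b
      have m3 := hH.next c
      have m4 := hH.next d
      have t1 : p (a + 1) = p (b + 1) := sj 0 hm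
      have t2 : p (a + 1) = p (c + 1) := sk 0 hm
      have t3 : p (a + 1) = p (d + 1) := sl 0 hm
      have u1 : p (a + m) = p (b + m) :=
        sj.eq_of_add (m - 1) (by omega) (by omega) (by omega)
      have u2 : p (a + m) = p (c + m) :=
        sk.eq_of_add (m - 1) (by omega) (by omega) (by omega)
      have u3 : p (a + m) = p (d + m) :=
        sl.eq_of_add (m - 1) (by omega) (by omega) (by omega)
      have h9 := fin_three_cases (p (a + 1))
      have h10 := fin_three_cases (p (a + m))
      have left_eq : p a = p b ∧ p c = p d ∧ p a ≠ p c := by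
        clear sj sk sl ri' rj' rk' rl' na nb nc nd
        grind
      clear sj sk sl m1 m2 m3 m4 pa' pb' pc' pd'
      grind
  obtain ⟨g1, g2, g3, g4⟩ := goal
  exact hH.not_hasStrong m ⟨a, b, c, d, g1, g2, g3, sj, sk, sl, g4⟩

end IsGBlock

section Factors

variable {A : Type*} {x : ℕ → A} {i j n : ℕ}

theorem length_factorAt : (FactorAt x i n).length = n := by
  simp [FactorAt]

theorem factorAt_eq_iff : FactorAt x i n = FactorAt x j n ↔ Agree x i j n := by
  simp [FactorAt, Agree]

theorem factorAt_succ : FactorAt x i (n + 1) = FactorAt x i n ++ [x (i + n)] := by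
  simp [FactorAt, List.range_succ]

theorem complexity_eq_ncard_range :
    complexity x n = (Set.range fun i => FactorAt x i n).ncard := by
  rw [complexity]
  congr 1
  ext w
  constructor
  · rintro ⟨rfl, i, hi⟩
    exact ⟨i, hi.symm⟩
  · rintro ⟨i, rfl⟩
    exact ⟨length_factorAt, i, by simp only [length_factorAt]⟩

/-- The factors of length `n` of `x` occurring immediately before an occurrence of `c`. -/
def factorsBefore (x : ℕ → A) (n : ℕ) (c : A) : Set (List A) :=
  {w | ∃ i, FactorAt x i n = w ∧ x (i + n) = c}

theorem finite_factorsBefore [Finite A] (c : A) : (factorsBefore x n c).Finite :=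
  (List.finite_length_eq A n).subset fun _ ⟨_, h, _⟩ => h ▸ length_factorAt

end Factors

theorem complexity_zero {A : Type*} (x : ℕ → A) : complexity x 0 = 1 := by
  rw [complexity_eq_ncard_range]
  simp [FactorAt]

theorem complexity_succ (x : ℕ → Fin 2) (n : ℕ) :
    complexity x (n + 1) =
      complexity x n + (factorsBefore x n 0 ∩ factorsBefore x n 1).ncard := by
  have inj : ∀ c : Fin 2, Function.Injective fun w : List (Fin 2) => w ++ [c] :=
    fun c => List.append_left_injective [c]
  have h1 : (Set.range fun i => FactorAt x i (n + 1)) =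
      (· ++ [0]) '' factorsBefore x n 0 ∪ (· ++ [1]) '' factorsBefore x n 1 := by
    ext w
    constructor
    · rintro ⟨i, rfl⟩
      simp only [factorAt_succ]
      obtain h | h : x (i + n) = 0 ∨ x (i + n) = 1 := by
        generalize x (i + n) = c; revert c; decide
      · exact Or.inl ⟨_, ⟨i, rfl, h⟩, by rw [h]⟩
      · exact Or.inr ⟨_, ⟨i, rfl, h⟩, by rw [h]⟩
    · rintro (⟨_, ⟨i, rfl, h⟩, rfl⟩ | ⟨_, ⟨i, rfl, h⟩, rfl⟩) <;>
        exact ⟨i, by simp only [factorAt_succ, h]⟩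
  have h2 : (Set.range fun i => FactorAt x i n) =
      factorsBefore x n 0 ∪ factorsBefore x n 1 := by
    ext w
    constructor
    · rintro ⟨i, rfl⟩
      obtain h | h : x (i + n) = 0 ∨ x (i + n) = 1 := by
        generalize x (i + n) = c; revert c; decide
      · exact Or.inl ⟨i, rfl, h⟩
      · exact Or.inr ⟨i, rfl, h⟩
    · rintro (⟨i, rfl, -⟩ | ⟨i, rfl, -⟩) <;> exact ⟨i, rfl⟩
  have hd : Disjoint ((· ++ [0]) '' factorsBefore x n 0) ((· ++ [1]) '' factorsBefore x n 1) := by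
    rw [Set.disjoint_left]
    rintro _ ⟨u, -, rfl⟩ ⟨v, -, h⟩
    have h := (List.append_inj' h rfl).2
    simp at h
  rw [complexity_eq_ncard_range, complexity_eq_ncard_range, h1, h2,
    Set.ncard_union_eq hd ((finite_factorsBefore 0).image _) ((finite_factorsBefore 1).image _),
    Set.ncard_image_of_injective _ (inj 0), Set.ncard_image_of_injective _ (inj 1),
    Set.ncard_union_add_ncard_inter _ _ (finite_factorsBefore 0) (finite_factorsBefore 1)]

namespace IsHBlock

variable {p : ℕ → Fin 3} {H : ℕ → ℕ}

theorem agree_image (hH : IsHBlock p H) {i j n : ℕ} (h : Agree p i j n) :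
    ∃ m, H (i + n) = H i + m ∧ H (j + n) = H j + m ∧ Agree p (H i) (H j) m ∧ n ≤ m := by
  induction n with
  | zero => exact ⟨0, rfl, rfl, fun t ht => by omega, le_rfl⟩
  | succ n ih =>
    obtain ⟨m, h1, h2, h3, h4⟩ := ih (h.mono n.le_succ)
    have e := h n n.lt_succ_self
    have s1 := hH.succ (i + n)
    have s2 := hH.succ (j + n)
    have f1 := hH.fst (i + n)
    have f2 := hH.fst (j + n)
    have t1 := hH.snd (i + n)
    have t2 := hH.snd (j + n)
    rw [← e] at s2 f2 t2
    rw [h1] at s1 f1 t1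
    rw [h2] at s2 f2 t2
    have h5 := h3.succ (f1.trans f2.symm)
    by_cases c : p (i + n) = 2
    · rw [if_pos c] at s1 s2
      exact ⟨m + 1, s1, s2, h5, by omega⟩
    · rw [if_neg c] at s1 s2
      exact ⟨m + 2, s1, s2, h5.succ ((t1 c).trans (t2 c).symm), by omega⟩

theorem exists_agree_one_two (hH : IsHBlock p H) (N : ℕ) :
    ∃ i j n, N ≤ n ∧ Agree p i j n ∧ p (i + n) = 1 ∧ p (j + n) = 2 := by
  induction N with
  | zero =>
    have h0 : p 0 = 0 := hH.zero
    have h1 : p 1 = 1 := by simpa [hH.start] using hH.snd 0 (by simp [h0])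
    have h2 : p 2 = 2 := by have := hH.fst 1; rwa [hH.one, h1] at this
    exact ⟨1, 2, 0, le_rfl, fun t ht => by omega, h1, h2⟩
  | succ N ih =>
    obtain ⟨i, j, n, hn, h, hi, hj⟩ := ih
    obtain ⟨m, h1, h2, h3, h4⟩ := hH.agree_image h
    have f1 := hH.fst (i + n)
    have f2 := hH.fst (j + n)
    simp only [hi, hj, h1, h2] at f1 f2
    obtain ⟨k, g1, g2, g3, g4⟩ := hH.agree_image h3
    have e1 := hH.fst (H i + m)
    have e2 := hH.fst (H j + m)
    have s1 := hH.succ_of_eq_two (n := H i + m) (by simpa using f1)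
    have v1 := hH.fst (H i + m + 1)
    have w1 := (hH.next (H i + m)).2.2 (by simpa using f1)
    have t2 := hH.snd (H j + m) (by simp [f2])
    rw [s1, w1] at v1
    rw [g1, f1] at e1
    rw [g2, f2] at e2
    refine ⟨H (H j), H (H i), k + 1, by omega, (g3.succ (e1.trans e2.symm)).symm, ?_, ?_⟩
    · rwa [g2, add_assoc] at t2
    · rwa [g1, add_assoc] at v1

theorem exists_agree_two_zero (hH : IsHBlock p H) (N : ℕ) :
    ∃ i j n, N ≤ n ∧ Agree p i j n ∧ p (i + n) = 2 ∧ p (j + n) = 0 := by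
  obtain ⟨i, j, n, hn, h, hi, hj⟩ := hH.exists_agree_one_two N
  obtain ⟨m, h1, h2, h3, h4⟩ := hH.agree_image h
  have f1 := hH.fst (i + n)
  have f2 := hH.fst (j + n)
  rw [hi, h1] at f1
  rw [hj, h2] at f2
  exact ⟨H i, H j, m, by omega, h3, f1, f2⟩

end IsHBlock

namespace IsGBlock

variable {p : ℕ → Fin 3} {q : ℕ → Fin 2} {G H : ℕ → ℕ}

theorem agree_image (hG : IsGBlock p q G) {i j n : ℕ} (h : Agree p i j n) :
    ∃ m, G (i + n) = G i + m ∧ G (j + n) = G j + m ∧ Agree q (G i) (G j) m ∧ n ≤ m := by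
  induction n with
  | zero => exact ⟨0, rfl, rfl, fun t ht => by omega, le_rfl⟩
  | succ n ih =>
    obtain ⟨m, h1, h2, h3, h4⟩ := ih (h.mono n.le_succ)
    have e := h n n.lt_succ_self
    have s1 := hG.succ (i + n)
    have s2 := hG.succ (j + n)
    have f := (hG.fst (i + n)).trans (hG.fst (j + n)).symm
    have t1 := hG.snd (i + n)
    have t2 := hG.snd (j + n)
    have u1 := hG.trd (i + n)
    have u2 := hG.trd (j + n)
    rw [← e] at s2 t2 u2
    rw [h1] at s1 t1 u1
    rw [h2] at s2 t2 u2
    rw [h1, h2] at f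
    have h5 := h3.succ f
    obtain c | c | c := fin_three_cases (p (i + n)) <;> simp [c] at s1 s2 t1 t2 u1 u2
    · exact ⟨m + 3, s1, s2, (h5.succ (t1.trans t2.symm)).succ (u1.trans u2.symm), by omega⟩
    · exact ⟨m + 1, s1, s2, h5, by omega⟩
    · exact ⟨m + 2, s1, s2, h5.succ (t1.trans t2.symm), by omega⟩

theorem exists_agree_zero_one (hG : IsGBlock p q G) (hH : IsHBlock p H) (c : Fin 2) (N : ℕ) :
    ∃ i j, Agree q i j (N + 1) ∧ q (i + N) = c ∧ q (i + (N + 1)) = 0 ∧ q (j + (N + 1)) = 1 := by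
  suffices ∃ i j n, N ≤ n ∧ Agree q i j (n + 1) ∧ q (i + n) = c ∧ q (i + (n + 1)) = 0 ∧
      q (j + (n + 1)) = 1 by
    obtain ⟨i, j, n, hn, h, h1, h2, h3⟩ := this
    obtain ⟨d, rfl⟩ := Nat.exists_eq_add_of_le hn
    exact ⟨i + d, j + d, h.shift d (by omega), by rw [← h1]; congr 1; ring,
      by rw [← h2]; congr 1; ring, by rw [← h3]; congr 1; ring⟩
  obtain hc | hc : c = 0 ∨ c = 1 := by revert c; decide
  · obtain ⟨i, j, n, hn, h, hi, hj⟩ := hH.exists_agree_one_two N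
    obtain ⟨m, h1, h2, h3, h4⟩ := hG.agree_image h
    have r1 := hG.read (i + n)
    have r2 := hG.read (j + n)
    have e1 := hG.fst (i + n)
    have e2 := hG.fst (j + n)
    simp [hi, hj, h1, h2] at r1 r2 e1 e2
    exact ⟨G i, G j, m, by omega, h3.succ (e1.trans e2.symm), e1.trans hc.symm, r1.1, r2.1⟩
  · obtain ⟨i, j, n, hn, h, hi, hj⟩ := hH.exists_agree_two_zero N
    obtain ⟨m, h1, h2, h3, h4⟩ := hG.agree_image h
    have r1 := hG.read (i + n)
    have r2 := hG.read (j + n)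
    have e1 := hG.fst (i + n)
    have e2 := hG.fst (j + n)
    simp [hi, hj, h1, h2] at r1 r2 e1 e2
    exact ⟨G i, G j, m + 1, by omega,
      (h3.succ (e1.trans e2.symm)).succ (r1.1.trans r2.1.symm), r1.1.trans hc.symm,
      r1.2.1, r2.2.1⟩

theorem agree_of_rightSpecial (hG : IsGBlock p q G) (hH : IsHBlock p H) {i j k l n : ℕ}
    (hij : Agree q i j (n + 1)) (hkl : Agree q k l (n + 1)) (hik : q (i + n) = q (k + n))
    (hi : q (i + (n + 1)) = 0) (hj : q (j + (n + 1)) = 1)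
    (hk : q (k + (n + 1)) = 0) (hl : q (l + (n + 1)) = 1) : Agree q i k (n + 1) := by
  induction n generalizing i j k l with
  | zero => exact fun t ht => by rw [Nat.lt_one_iff.1 ht]; exact hik
  | succ n ih =>
    have e : ∀ a b, a + 1 + b = a + (b + 1) := fun a b => by ring
    have := ih (hij.shift 1 le_rfl) (hkl.shift 1 le_rfl) (by rwa [e, e]) (by rwa [e]) (by rwa [e])
      (by rwa [e]) (by rwa [e])
    refine this.cons (by_contra fun hne => hG.not_hasStrong hH (Nat.le_add_left 1 n) ?_)
    exact ⟨i, j, k, l, hij 0 (by omega), hkl 0 (by omega), hne, hij.shift 1 le_rfl, this,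
      this.trans (hkl.shift 1 le_rfl), by rw [e, hi, e, hk], by rw [e, hj, e, hl],
      by rw [e, hi, e, hj]; decide⟩

theorem ncard_rightSpecial (hG : IsGBlock p q G) (hH : IsHBlock p H) (n : ℕ) :
    (factorsBefore q (n + 1) 0 ∩ factorsBefore q (n + 1) 1).ncard = 2 := by
  obtain ⟨i, j, hij, ci, hi, hj⟩ := hG.exists_agree_zero_one hH 0 n
  obtain ⟨k, l, hkl, ck, hk, hl⟩ := hG.exists_agree_zero_one hH 1 n
  rw [Set.ncard_eq_two]
  refine ⟨FactorAt q i (n + 1), FactorAt q k (n + 1), fun h => ?_, ?_⟩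
  · have := factorAt_eq_iff.1 h n n.lt_succ_self
    rw [ci, ck] at this
    exact absurd this (by decide)
  · ext w
    constructor
    · rintro ⟨⟨a, rfl, ha⟩, b, hb, hb'⟩
      have hab := factorAt_eq_iff.1 hb.symm
      obtain c | c : q (a + n) = 0 ∨ q (a + n) = 1 := by
        generalize q (a + n) = c; revert c; decide
      · exact Or.inl (factorAt_eq_iff.2
          (hG.agree_of_rightSpecial hH hab hij (c.trans ci.symm) ha hb' hi hj))
      · exact Or.inr (factorAt_eq_iff.2
          (hG.agree_of_rightSpecial hH hab hkl (c.trans ck.symm) ha hb' hk hl))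
    · rintro (rfl | rfl)
      · exact ⟨⟨i, rfl, hi⟩, j, factorAt_eq_iff.2 hij.symm, hj⟩
      · exact ⟨⟨k, rfl, hk⟩, l, factorAt_eq_iff.2 hkl.symm, hl⟩

theorem complexity_eq (hG : IsGBlock p q G) (hH : IsHBlock p H) (n : ℕ) (hn : 1 ≤ n) :
    complexity q n = 2 * n := by
  induction n, hn using Nat.le_induction with
  | base =>
    rw [complexity_succ, complexity_zero]
    have : factorsBefore q 0 0 ∩ factorsBefore q 0 1 = {[]} := by
      ext w
      constructor
      · rintro ⟨⟨i, rfl, -⟩, -⟩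
        rfl
      · rintro rfl
        obtain ⟨i, j, -, -, hi, hj⟩ := hG.exists_agree_zero_one hH 0 0
        exact ⟨⟨i + 1, rfl, hi⟩, j + 1, rfl, hj⟩
    simp [this]
  | succ n hn ih =>
    obtain ⟨n, rfl⟩ := Nat.exists_eq_add_of_le' hn
    rw [complexity_succ, ih, hG.ncard_rightSpecial hH]
    ring

end IsGBlock

/-- The length of `g (h^k (c))`. -/
def imageLength : ℕ → Fin 3 → ℕ
  | 0 => ![3, 1, 2]
  | k + 1 => ![imageLength k 0 + imageLength k 1, imageLength k 2 + imageLength k 1,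
      imageLength k 0]

/-- The length of `g (h^k (x 0 ⋯ x (n - 1)))`. -/
def prefixLength (x : ℕ → Fin 3) (k n : ℕ) : ℕ := ∑ t ∈ Finset.range n, imageLength k (x t)

/-- Twice the length by which a repetition of `h^k (p)` may extend to the left in `q`; the flag
records whether the letters preceding its two occurrences are `0` and `1`. -/
def leftCost : ℕ → Bool → ℕ
  | 0, _ => 2
  | k + 1, false => leftCost k true
  | k + 1, true => 2 * imageLength k 1 + leftCost k false

/-- Twice the length by which a repetition of `h^k (p)` may extend to the right in `q`; the flag
records whether the letters following its two occurrences are `0` and `2`. -/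
def rightCost : ℕ → Bool → ℕ
  | 0, false => 2
  | 0, true => 4
  | k + 1, false => rightCost k true
  | k + 1, true => 2 * imageLength k 0 + rightCost k false

section Costs

theorem imageLength_succ_zero (k : ℕ) :
    imageLength (k + 1) 0 = imageLength k 0 + imageLength k 1 := rfl

theorem imageLength_succ_one (k : ℕ) :
    imageLength (k + 1) 1 = imageLength k 2 + imageLength k 1 := rfl

theorem imageLength_succ_two (k : ℕ) : imageLength (k + 1) 2 = imageLength k 0 := rfl

theorem leftCost_succ_false (k : ℕ) : leftCost (k + 1) false = leftCost k true := rfl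

theorem leftCost_succ_true (k : ℕ) :
    leftCost (k + 1) true = 2 * imageLength k 1 + leftCost k false := rfl

theorem rightCost_succ_false (k : ℕ) : rightCost (k + 1) false = rightCost k true := rfl

theorem rightCost_succ_true (k : ℕ) :
    rightCost (k + 1) true = 2 * imageLength k 0 + rightCost k false := rfl

theorem imageLength_le_zero (k : ℕ) :
    imageLength k 1 ≤ imageLength k 0 ∧ imageLength k 2 ≤ imageLength k 0 := by
  induction k with
  | zero => decide
  | succ k ih =>
    rw [imageLength_succ_zero, imageLength_succ_one, imageLength_succ_two]
    omega

theorem leftCost_le_true (k : ℕ) (α : Bool) :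
    leftCost k α ≤ leftCost k true ∧ leftCost k true ≤ leftCost (k + 1) true := by
  suffices leftCost k false ≤ leftCost k true ∧ leftCost k true ≤ leftCost (k + 1) true by
    cases α <;> simp [this]
  induction k with
  | zero => decide
  | succ k ih =>
    rw [leftCost_succ_false, leftCost_succ_true (k + 1), leftCost_succ_false,
      leftCost_succ_true k, imageLength_succ_one]
    rw [leftCost_succ_true] at ih
    omega

theorem rightCost_le_true (k : ℕ) (β : Bool) :
    rightCost k β ≤ rightCost k true ∧ rightCost k true ≤ rightCost (k + 1) true := by
  suffices rightCost k false ≤ rightCost k true ∧ rightCost k true ≤ rightCost (k + 1) true by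
    cases β <;> simp [this]
  induction k with
  | zero => decide
  | succ k ih =>
    rw [rightCost_succ_false, rightCost_succ_true (k + 1), rightCost_succ_false,
      rightCost_succ_true k, imageLength_succ_zero]
    rw [rightCost_succ_true] at ih
    omega

theorem cost_true_true_le (k : ℕ) :
    leftCost k true + rightCost k true ≤ 3 * imageLength k 0 := by
  have key : ∀ k, 2 * imageLength (k + 1) 0 ≤
      2 * imageLength (k + 1) 1 + imageLength (k + 1) 2 := by
    intro k
    obtain _ | _ | _ | k := k
    · decide
    · decide
    · decide
    · simp only [imageLength_succ_zero, imageLength_succ_one, imageLength_succ_two]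
      omega
  induction k using Nat.twoStepInduction with
  | zero => decide
  | one => decide
  | more k ih _ =>
    obtain _ | k := k
    · decide
    · have := key k
      rw [leftCost_succ_true, rightCost_succ_true, leftCost_succ_false, rightCost_succ_false,
        imageLength_succ_zero (k + 1 + 1), imageLength_succ_zero (k + 1),
        imageLength_succ_one (k + 1)]
      omega

theorem cost_true_false_le (k : ℕ) :
    leftCost (k + 1) true + rightCost (k + 1) false ≤ 3 * imageLength (k + 1) 1 := by
  have key : ∀ k, 2 * imageLength (k + 3) 1 ≤
      imageLength (k + 3) 0 + imageLength (k + 3) 2 := by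
    intro k
    obtain _ | k := k
    · decide
    · simp only [imageLength_succ_zero, imageLength_succ_one, imageLength_succ_two]
      omega
  induction k using Nat.twoStepInduction with
  | zero => decide
  | one => decide
  | more k ih _ =>
    obtain _ | _ | k := k
    · decide
    · decide
    · have := key k
      simp only [leftCost_succ_true, rightCost_succ_true, leftCost_succ_false,
        rightCost_succ_false, imageLength_succ_zero, imageLength_succ_one,
        imageLength_succ_two] at ih this ⊢
      omega

theorem cost_false_false_le (k : ℕ) :
    leftCost k false + rightCost k false ≤ 3 * imageLength k 2 := by
  obtain _ | k := k
  · decide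
  · exact cost_true_true_le k

theorem cost_true_true_le_add (k : ℕ) :
    leftCost k true + rightCost k true ≤ 3 * (imageLength k 1 + imageLength k 2) := by
  induction k using Nat.twoStepInduction with
  | zero => decide
  | one => decide
  | more k ih _ =>
    have := imageLength_le_zero k
    simp only [leftCost_succ_true, rightCost_succ_true, leftCost_succ_false,
      rightCost_succ_false, imageLength_succ_zero, imageLength_succ_one,
      imageLength_succ_two]
    omega

theorem prefixLength_succ (x : ℕ → Fin 3) (k n : ℕ) :
    prefixLength x k (n + 1) = prefixLength x k n + imageLength k (x n) :=
  Finset.sum_range_succ _ _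

theorem prefixLength_mono (x : ℕ → Fin 3) (k : ℕ) : Monotone (prefixLength x k) :=
  monotone_nat_of_le_succ fun n => by rw [prefixLength_succ]; omega

end Costs

namespace IsHBlock

variable {p : ℕ → Fin 3} {H : ℕ → ℕ}

theorem prefixLength_apply (hH : IsHBlock p H) (k n : ℕ) :
    prefixLength p k (H n) = prefixLength p (k + 1) n := by
  induction n with
  | zero => simp [hH.start, prefixLength]
  | succ n ih =>
    have s := hH.succ n
    have f := hH.fst n
    have g := hH.snd n
    rw [prefixLength_succ, ← ih]
    obtain c | c | c := fin_three_cases (p n) <;> simp [c] at s f g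
    · rw [s, c, prefixLength_succ, prefixLength_succ, f, g, imageLength_succ_zero, add_assoc]
    · rw [s, c, prefixLength_succ, prefixLength_succ, f, g, imageLength_succ_one, add_assoc]
    · rw [s, c, prefixLength_succ, f, imageLength_succ_two]

theorem cost_le_of_lt (hH : IsHBlock p H) {k i j : ℕ} {α β : Bool} (hij : i < j)
    (h2 : prefixLength p k i + 2 ≤ prefixLength p k j)
    (hα : α = true → 1 ≤ i ∧ (p (i - 1) = 0 ∧ p (j - 1) = 1 ∨ p (i - 1) = 1 ∧ p (j - 1) = 0))
    (hβ : β = true → p i = 0 ∧ p j = 2 ∨ p i = 2 ∧ p j = 0) :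
    3 * prefixLength p k i + leftCost k α + rightCost k β ≤ 3 * prefixLength p k j := by
  have a1 := (leftCost_le_true k α).1
  have b1 := (rightCost_le_true k β).1
  have e1 := cost_true_true_le k
  have e3 := cost_false_false_le k
  have e4 := cost_true_true_le_add k
  have s := prefixLength_succ p k i
  have nx := hH.next i
  obtain rfl | hij := Nat.eq_or_lt_of_le (Nat.succ_le_of_lt hij)
  · rw [Nat.succ_eq_add_one] at *
    obtain c | c | c := fin_three_cases (p i)
    · rw [c] at s
      omega
    · obtain _ | k := k
      · rw [s, c] at h2
        simp [imageLength] at h2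
      · have e2 := cost_true_false_le k
        have : β = false := by simpa [c] using hβ
        subst this
        rw [c] at s
        omega
    · have hn := nx.2.2 c
      have h1 : β = false := by simpa [c, hn] using hβ
      have h2 : α = false := by simpa [c] using hα
      subst h1 h2
      rw [c] at s
      omega
  · have s2 := prefixLength_succ p k (i + 1)
    have m := prefixLength_mono p k hij
    rw [Nat.succ_eq_add_one] at m
    obtain c | c | c := fin_three_cases (p i) <;>
    obtain d | d | d := fin_three_cases (p (i + 1)) <;>
      rw [c] at s <;> rw [d] at s2 <;> simp [c, d] at nx <;> omega

theorem exists_of_eq_of_one (hH : IsHBlock p H) {e f : ℕ} (h : p e = p f) (he : p (e + 1) = 1)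
    (hf : p (f + 1) ≠ 1) : ∃ w z, H w = e ∧ H z = f ∧ p w = 0 ∧ p z = 2 ∧ p e = 0 := by
  have c : p e ≠ 1 := fun c => (hH.next e).2.1 c he
  obtain ⟨w, rfl⟩ := hH.exists_of_ne_one c
  obtain ⟨z, rfl⟩ := hH.exists_of_ne_one (h ▸ c)
  have hz : p z = 2 := by_contra fun hz => hf (hH.snd z hz)
  have fz := hH.fst z
  have fw := hH.fst w
  have sw := hH.fst_ne_one (w + 1)
  rw [hz] at fz
  rw [h, fz] at fw
  refine ⟨w, z, rfl, rfl, ?_, hz, by simpa [fz] using h⟩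
  obtain c | c | c := fin_three_cases (p w)
  · exact c
  · simp [c] at fw
  · rw [hH.succ_of_eq_two c] at sw
    exact absurd he sw

/-- Cutting the right end of a repetition of `p` at a block boundary. -/
theorem exists_right_cut (hH : IsHBlock p H) {i j l : ℕ} (k : ℕ) {β : Bool} (hl : 1 ≤ l)
    (h : Agree p i j l)
    (hβ : β = true → p (i + l) = 0 ∧ p (j + l) = 2 ∨ p (i + l) = 2 ∧ p (j + l) = 0) :
    ∃ w z n β', Agree p i j n ∧ H w = i + n ∧ H z = j + n ∧
      (β' = true → p w = 0 ∧ p z = 2 ∨ p w = 2 ∧ p z = 0) ∧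
      2 * prefixLength p k (i + l) + rightCost k β ≤
        2 * prefixLength p k (i + n) + rightCost (k + 1) β' := by
  have b1 := (rightCost_le_true k β).1
  by_cases ci : p (i + l) = 1 <;> by_cases cj : p (j + l) = 1
  · have ni := (hH.next (i + l)).2.1 ci
    have nj := (hH.next (j + l)).2.1 cj
    obtain ⟨w, hw⟩ := hH.exists_of_ne_one ni
    obtain ⟨z, hz⟩ := hH.exists_of_ne_one nj
    refine ⟨w, z, l + 1, false, h.succ (ci.trans cj.symm), hw, hz, by simp, ?_⟩
    have := prefixLength_mono p k (Nat.le_succ (i + l))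
    rw [rightCost_succ_false]
    rw [Nat.succ_eq_add_one, add_assoc] at this
    omega
  · obtain ⟨l, rfl⟩ := Nat.exists_eq_add_of_le' hl
    have hβ0 : β = false := by simpa [ci, cj] using hβ
    subst hβ0
    obtain ⟨w, z, hw, hz, pw, pz, e⟩ := hH.exists_of_eq_of_one (h l l.lt_succ_self) ci cj
    refine ⟨w, z, l, true, h.mono l.le_succ, hw, hz, by simp [pw, pz], ?_⟩
    rw [rightCost_succ_true, ← add_assoc, prefixLength_succ, e]
    omega
  · obtain ⟨l, rfl⟩ := Nat.exists_eq_add_of_le' hl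
    have hβ0 : β = false := by simpa [ci, cj] using hβ
    subst hβ0
    obtain ⟨z, w, hz, hw, pz, pw, e⟩ := hH.exists_of_eq_of_one (h l l.lt_succ_self).symm cj ci
    refine ⟨w, z, l, true, h.mono l.le_succ, hw, hz, by simp [pw, pz], ?_⟩
    rw [rightCost_succ_true, ← add_assoc, prefixLength_succ,
      h l l.lt_succ_self, e]
    omega
  · obtain ⟨w, hw⟩ := hH.exists_of_ne_one ci
    obtain ⟨z, hz⟩ := hH.exists_of_ne_one cj
    refine ⟨w, z, l, false, h, hw, hz, by simp, ?_⟩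
    rw [rightCost_succ_false]
    omega

/-- Cutting the left end of a repetition of `p` at a block boundary. -/
theorem exists_left_cut (hH : IsHBlock p H) {i j n w z : ℕ} (k : ℕ) {α : Bool} (hij : i < j)
    (hp : p i = p j) (h : Agree p i j n) (hw : H w = i + n) (hz : H z = j + n)
    (hα : α = true → 1 ≤ i ∧ (p (i - 1) = 0 ∧ p (j - 1) = 1 ∨ p (i - 1) = 1 ∧ p (j - 1) = 0)) :
    ∃ u v m α', u < v ∧ v < j ∧ H u + m = i + n ∧ H v + m = j + n ∧ Agree p (H u) (H v) m ∧
      (α' = true → 1 ≤ u ∧ (p (u - 1) = 0 ∧ p (v - 1) = 1 ∨ p (u - 1) = 1 ∧ p (v - 1) = 0)) ∧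
      2 * prefixLength p k (H u) + leftCost k α ≤
        2 * prefixLength p k i + leftCost (k + 1) α' ∧
      prefixLength p k (H v) + prefixLength p k i =
        prefixLength p k j + prefixLength p k (H u) := by
  have a1 := (leftCost_le_true k α).1
  by_cases c : p i = 1
  · have d := hp ▸ c
    obtain ⟨a, ha, rfl⟩ := hH.exists_of_eq_one c
    obtain ⟨b, hb, rfl⟩ := hH.exists_of_eq_one d
    have hab : a < b := hH.strictMono.lt_iff_lt.1 (by omega)
    have hn : 1 ≤ n := by
      by_contra h0
      obtain rfl : n = 0 := by omega
      exact hH.fst_ne_one w (hw ▸ c)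
    have hbs := hH.lt_self (n := b) (by omega)
    have fa := hH.fst a
    have fb := hH.fst b
    have sa := prefixLength_succ p k (H a)
    have sb := prefixLength_succ p k (H b)
    by_cases e : p a = p b
    · rw [← e, ← fa] at fb
      refine ⟨a, b, n + 1, false, hab, by omega, by omega, by omega, h.cons fb.symm, by simp,
        ?_, ?_⟩
      · rw [leftCost_succ_false]
        omega
      · rw [fb] at sb
        omega
    · have hα0 : α = false := by
        obtain c1 | c1 | c1 := fin_three_cases (p a) <;>
        obtain c2 | c2 | c2 := fin_three_cases (p b) <;> simp_all
      subst hα0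
      have na := hH.succ_of_ne_two ha
      have nb := hH.succ_of_ne_two hb
      refine ⟨a + 1, b + 1, n - 1, true, by omega, ?_, by omega, by omega, ?_, fun _ => ?_, ?_, ?_⟩
      · have := hH.add_one_lt_self (n := b + 1) (by omega)
        omega
      · rw [na, nb]
        exact h.shift 1 (by omega)
      · simp only [Nat.add_sub_cancel]
        obtain c1 | c1 | c1 := fin_three_cases (p a) <;>
        obtain c2 | c2 | c2 := fin_three_cases (p b) <;> simp_all
      · rw [leftCost_succ_true, na]
        have := prefixLength_succ p k (H a + 1)
        rw [c] at this
        rw [show H a + 2 = H a + 1 + 1 from rfl]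
        omega
      · rw [na, nb, show H a + 2 = H a + 1 + 1 from rfl, show H b + 2 = H b + 1 + 1 from rfl,
          prefixLength_succ, prefixLength_succ p k (H a + 1), c, d]
        omega
  · obtain ⟨u, rfl⟩ := hH.exists_of_ne_one c
    obtain ⟨v, rfl⟩ := hH.exists_of_ne_one (hp ▸ c)
    have huv : u < v := hH.strictMono.lt_iff_lt.1 hij
    refine ⟨u, v, n, false, huv, hH.lt_self (by omega), rfl, rfl, h, by simp, ?_, rfl⟩
    rw [leftCost_succ_false]
    omega

theorem two_mul_prefixLength_add_cost_le (hH : IsHBlock p H) {k i j l : ℕ} {α β : Bool}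
    (hij : i < j) (h : Agree p i j l) (h2 : prefixLength p k i + 2 ≤ prefixLength p k j)
    (hα : α = true → 1 ≤ i ∧ (p (i - 1) = 0 ∧ p (j - 1) = 1 ∨ p (i - 1) = 1 ∧ p (j - 1) = 0))
    (hβ : β = true → p (i + l) = 0 ∧ p (j + l) = 2 ∨ p (i + l) = 2 ∧ p (j + l) = 0) :
    2 * prefixLength p k (i + l) + prefixLength p k i + leftCost k α + rightCost k β ≤
      3 * prefixLength p k j := by
  induction j using Nat.strong_induction_on generalizing k i l α β with
  | _ j ih =>
  obtain rfl | hl := Nat.eq_zero_or_pos l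
  · have := hH.cost_le_of_lt hij h2 hα hβ
    rw [add_zero]
    omega
  · obtain ⟨w, z, n, β', hn, hw, hz, hβ', hr⟩ := hH.exists_right_cut k hl h hβ
    obtain ⟨u, v, m, α', huv, hvj, hu, hv, hag, hα', hL, hS⟩ :=
      hH.exists_left_cut k hij (h 0 hl) hn hw hz hα
    obtain ⟨d, rfl⟩ : ∃ d, w = u + d :=
      Nat.exists_eq_add_of_le (hH.strictMono.le_iff_le.1 (by omega))
    obtain ⟨hd, hvd⟩ := hH.agree_of_agree hag (hw.trans hu.symm)
      (by rw [hv, ← hz]; exact hH.fst_ne_one z)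
    obtain rfl : z = v + d := hH.strictMono.injective (by omega)
    have := ih v hvj huv hd (k := k + 1)
      (by rw [← hH.prefixLength_apply, ← hH.prefixLength_apply]; omega) hα' hβ'
    simp only [← hH.prefixLength_apply] at this
    rw [hw] at this
    omega

end IsHBlock

namespace IsGBlock

variable {p : ℕ → Fin 3} {q : ℕ → Fin 2} {G H : ℕ → ℕ}

theorem prefixLength_zero (hG : IsGBlock p q G) (n : ℕ) : prefixLength p 0 n = G n := by
  induction n with
  | zero => simp [hG.start, prefixLength]
  | succ n ih =>
    rw [prefixLength_succ, ih, hG.succ]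
    obtain c | c | c := fin_three_cases (p n) <;> simp [c, imageLength]

theorem not_const (hG : IsGBlock p q G) (hH : IsHBlock p H) {i : ℕ} (h : Agree q i (i + 1) 2) :
    False := by
  have h0 : q i = q (i + 1) := h 0 (by omega)
  have h1 : q (i + 1) = q (i + 2) := h 1 (by omega)
  by_cases c : q i = 0
  · obtain ⟨a, rfl⟩ := hG.exists_of_zero c
    have r := hG.read a
    have r' := hG.read (a + 1)
    have := (hH.next a).2.1
    grind
  · have := hG.not_one_one_one i
    grind

theorem exists_right_cut_of_ne (hG : IsGBlock p q G) {i j l : ℕ} (hl : 2 ≤ l)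
    (h : Agree q i j l) (hi : q (i + l) = 0) (hj : q (j + l) = 1) :
    ∃ w z n β, Agree q i j n ∧ G w = i + n ∧ G z = j + n ∧
      (β = true → p w = 2 ∧ p z = 0) ∧ 2 * l ≤ 2 * n + rightCost 0 β := by
  obtain ⟨l, rfl⟩ := Nat.exists_eq_add_of_le' hl
  have h0 : q (i + l) = q (j + l) := h l (by omega)
  have h1 : q (i + (l + 1)) = q (j + (l + 1)) := h (l + 1) (by omega)
  by_cases c : q (i + (l + 1)) = 0
  · obtain ⟨w, hw⟩ := hG.exists_of_zero c
    obtain ⟨z, hz⟩ := hG.exists_of_zero (h1 ▸ c)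
    exact ⟨w, z, l + 1, false, h.mono (by omega), hw, hz, by simp, by simp [rightCost]; omega⟩
  · have n1 := hG.not_one_one_one (j + l)
    have c0 : q (j + l) = 0 := by grind
    obtain ⟨w, hw⟩ := hG.exists_of_zero (h0 ▸ c0)
    obtain ⟨z, hz⟩ := hG.exists_of_zero c0
    refine ⟨w, z, l, true, h.mono (by omega), hw, hz, fun _ => ?_, by simp [rightCost]; omega⟩
    have r := hG.read w
    have r' := hG.read z
    rw [hw] at r
    rw [hz] at r'
    grind

theorem exists_right_cut (hG : IsGBlock p q G) {i j l : ℕ} (hl : 2 ≤ l) (h : Agree q i j l) :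
    ∃ w z n β, Agree q i j n ∧ G w = i + n ∧ G z = j + n ∧
      (β = true → p w = 0 ∧ p z = 2 ∨ p w = 2 ∧ p z = 0) ∧ 2 * l ≤ 2 * n + rightCost 0 β := by
  have step : ∀ l, 2 ≤ l → Agree q i j l → (∃ w z n β, Agree q i j n ∧ G w = i + n ∧
      G z = j + n ∧ (β = true → p w = 0 ∧ p z = 2 ∨ p w = 2 ∧ p z = 0) ∧
      2 * l ≤ 2 * n + rightCost 0 β) ∨ q (i + l) = 1 ∧ Agree q i j (l + 1) := by
    intro l hl h
    by_cases ci : q (i + l) = 0 <;> by_cases cj : q (j + l) = 0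
    · obtain ⟨w, hw⟩ := hG.exists_of_zero ci
      obtain ⟨z, hz⟩ := hG.exists_of_zero cj
      exact Or.inl ⟨w, z, l, false, h, hw, hz, by simp, by omega⟩
    · obtain ⟨w, z, n, β, hn, hw, hz, hβ, hr⟩ :=
        hG.exists_right_cut_of_ne hl h ci (eq_one_of_ne cj)
      exact Or.inl ⟨w, z, n, β, hn, hw, hz, fun hb => Or.inr (hβ hb), hr⟩
    · obtain ⟨z, w, n, β, hn, hz, hw, hβ, hr⟩ :=
        hG.exists_right_cut_of_ne hl h.symm cj (eq_one_of_ne ci)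
      exact Or.inl ⟨w, z, n, β, hn.symm, hw, hz, fun hb => Or.inl (hβ hb).symm, hr⟩
    · exact Or.inr ⟨eq_one_of_ne ci, h.succ ((eq_one_of_ne ci).trans (eq_one_of_ne cj).symm)⟩
  obtain h0 | ⟨c0, h0⟩ := step l hl h
  · exact h0
  obtain ⟨w, z, n, β, hn, hw, hz, hβ, hr⟩ | ⟨c1, h1⟩ := step (l + 1) (by omega) h0
  · exact ⟨w, z, n, β, hn, hw, hz, hβ, by omega⟩
  obtain ⟨w, z, n, β, hn, hw, hz, hβ, hr⟩ | ⟨c2, h2⟩ := step (l + 2) (by omega) h1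
  · exact ⟨w, z, n, β, hn, hw, hz, hβ, by omega⟩
  have := hG.not_one_one_one (i + l)
  simp only [add_assoc, c0, c1, c2] at this
  simp at this

theorem exists_left_cut (hG : IsGBlock p q G) {i j n w z : ℕ} (hij : i < j)
    (hq : q i = q j) (h : Agree q i j n) (hw : G w = i + n) (hz : G z = j + n) :
    ∃ u v m, u < v ∧ G u + m = i + n ∧ G v + m = j + n ∧ Agree q (G u) (G v) m ∧
      G u ≤ i + 1 := by
  by_cases c : q i = 0
  · obtain ⟨u, rfl⟩ := hG.exists_of_zero c
    obtain ⟨v, rfl⟩ := hG.exists_of_zero (hq ▸ c)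
    exact ⟨u, v, n, hG.strictMono.lt_iff_lt.1 hij, rfl, rfl, h, by omega⟩
  have fw := hG.fst w
  have hn : n ≠ 0 := by
    rintro rfl
    rw [hw] at fw
    exact c fw
  have h1 : q (i + 1) = q (j + 1) := by
    by_cases hn : n = 1
    · have fz := hG.fst z
      rw [hw, hn] at fw
      rw [hz, hn] at fz
      rw [fw, fz]
    · exact h 1 (by omega)
  by_cases d : q (i + 1) = 0
  · obtain ⟨u, hu⟩ := hG.exists_of_zero d
    obtain ⟨v, hv⟩ := hG.exists_of_zero (h1 ▸ d)
    refine ⟨u, v, n - 1, hG.strictMono.lt_iff_lt.1 (by omega), by omega, by omega, ?_, by omega⟩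
    rw [hu, hv]
    exact h.shift 1 (by omega)
  · have key : ∀ x, q x ≠ 0 → q (x + 1) ≠ 0 → ∃ a, x = G a + 1 := by
      intro x hx hx'
      obtain ⟨a, rfl | ⟨-, rfl⟩ | ⟨ha, rfl⟩⟩ := hG.cover x
      · exact absurd (hG.fst a) hx
      · exact ⟨a, rfl⟩
      · have s := hG.succ a
        rw [if_pos ha] at s
        exact absurd (s ▸ hG.fst (a + 1)) hx'
    obtain ⟨u, rfl⟩ := key i c d
    obtain ⟨v, rfl⟩ := key j (hq ▸ c) (h1 ▸ d)
    exact ⟨u, v, n + 1, hG.strictMono.lt_iff_lt.1 (by omega), by omega, by omega,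
      h.cons ((hG.fst u).trans (hG.fst v).symm), by omega⟩

theorem two_mul_le_three_mul (hG : IsGBlock p q G) (hH : IsHBlock p H) {i j l : ℕ}
    (hij : i < j) (h : Agree q i j l) : 2 * l ≤ 3 * (j - i) := by
  by_cases hl : l ≤ 1
  · omega
  have hj : i + 2 ≤ j := by
    by_contra hj
    obtain rfl : j = i + 1 := by omega
    exact hG.not_const hH (h.mono (by omega))
  obtain ⟨w, z, n, β, hn, hw, hz, hβ, hr⟩ := hG.exists_right_cut (by omega) h
  obtain ⟨u, v, m, huv, hu, hv, hag, hL⟩ := hG.exists_left_cut hij (h 0 (by omega)) hn hw hz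
  obtain ⟨d, rfl⟩ : ∃ d, w = u + d :=
    Nat.exists_eq_add_of_le (hG.strictMono.le_iff_le.1 (by omega))
  obtain ⟨hd, hvd⟩ := hG.agree_of_agree hag (hw.trans hu.symm)
    (by rw [hv, ← hz]; exact hG.fst z)
  obtain rfl : z = v + d := hG.strictMono.injective (by omega)
  have := hH.two_mul_prefixLength_add_cost_le huv hd (k := 0) (α := false)
    (by rw [hG.prefixLength_zero, hG.prefixLength_zero]; omega) (by simp) hβ
  simp only [hG.prefixLength_zero, leftCost] at this
  omega

theorem factorAt_eleven (hG : IsGBlock p q G) (hH : IsHBlock p H) :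
    FactorAt q 11 10 = [1, 0, 0, 1, 1, 0, 0, 1, 1, 0] := by
  have start_succ := hH.succ
  have letter := hH.fst
  have letter' := hH.snd
  have p0 : p 0 = 0 := hH.zero
  have H1 : H 1 = 2 := hH.one
  have p1 : p 1 = 1 := by simpa [hH.start, p0] using letter' 0
  have p2 : p 2 = 2 := by simpa [H1, p1] using letter 1
  have p3 : p 3 = 1 := by simpa [H1, p1] using letter' 1
  have H2 : H 2 = 4 := by simpa [H1, p1] using start_succ 1
  have H3 : H 3 = 5 := by simpa [H2, p2] using start_succ 2
  have p4 : p 4 = 0 := by simpa [H2, p2] using letter 2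
  have p5 : p 5 = 2 := by simpa [H3, p3] using letter 3
  have p6 : p 6 = 1 := by simpa [H3, p3] using letter' 3
  have H4 : H 4 = 7 := by simpa [H3, p3] using start_succ 3
  have p7 : p 7 = 0 := by simpa [H4, p4] using letter 4
  have p8 : p 8 = 1 := by simpa [H4, p4] using letter' 4
  have H5 : H 5 = 9 := by simpa [H4, p4] using start_succ 4
  have p9 : p 9 = 0 := by simpa [H5, p5] using letter 5
  have G1 : G 1 = 3 := by simpa [hG.start, p0] using hG.succ 0
  have G2 : G 2 = 4 := by simpa [G1, p1] using hG.succ 1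
  have G3 : G 3 = 6 := by simpa [G2, p2] using hG.succ 2
  have G4 : G 4 = 7 := by simpa [G3, p3] using hG.succ 3
  have G5 : G 5 = 10 := by simpa [G4, p4] using hG.succ 4
  have G6 : G 6 = 12 := by simpa [G5, p5] using hG.succ 5
  have G7 : G 7 = 13 := by simpa [G6, p6] using hG.succ 6
  have G8 : G 8 = 16 := by simpa [G7, p7] using hG.succ 7
  have G9 : G 9 = 17 := by simpa [G8, p8] using hG.succ 8
  have G10 : G 10 = 20 := by simpa [G9, p9] using hG.succ 9
  have q11 : q 11 = 1 := by simpa [G5, p5] using hG.snd 5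
  have q12 : q 12 = 0 := by simpa [G6] using hG.fst 6
  have q13 : q 13 = 0 := by simpa [G7] using hG.fst 7
  have q14 : q 14 = 1 := by simpa [G7, p7] using hG.snd 7
  have q15 : q 15 = 1 := by simpa [G7, p7] using hG.trd 7
  have q16 : q 16 = 0 := by simpa [G8] using hG.fst 8
  have q17 : q 17 = 0 := by simpa [G9] using hG.fst 9
  have q18 : q 18 = 1 := by simpa [G9, p9] using hG.snd 9
  have q19 : q 19 = 1 := by simpa [G9, p9] using hG.trd 9
  have q20 : q 20 = 0 := by simpa [G10] using hG.fst 10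
  simp [FactorAt, List.range_succ, q11, q12, q13, q14, q15, q16, q17, q18, q19, q20]

end IsGBlock

theorem minPeriod_mem {A : Type*} [Inhabited A] {w : List A} (hw : w ≠ []) :
    HasPeriod w (minPeriod w) :=
  Nat.sInf_mem (s := {p | HasPeriod w p})
    ⟨w.length, List.length_pos_iff.2 hw, le_rfl, fun j hj => by omega⟩

theorem Agree.of_hasPeriod {A : Type*} [Inhabited A] {x : ℕ → A} {i n P : ℕ}
    (h : HasPeriod (FactorAt x i n) P) : Agree x i (i + P) (n - P) := by
  intro t ht
  have := h.2.2 t (by rw [length_factorAt]; omega)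
  simp only [FactorAt, List.getD_eq_getElem?_getD, List.getElem?_map] at this
  rw [List.getElem?_range (by omega), List.getElem?_range (by omega)] at this
  rw [add_assoc, add_comm P t]
  simpa using this

theorem exponent_le {x : ℕ → Fin 2} (hx : ∀ i j l, i < j → Agree x i j l → 2 * l ≤ 3 * (j - i))
    {w : List (Fin 2)} (hw : IsFactor x w) (hne : w ≠ []) : exponent w ≤ 5 / 2 := by
  have hP := minPeriod_mem hne
  obtain ⟨i, hi⟩ := hw
  have := hx i (i + minPeriod w) _ (by have := hP.1; omega)
    (Agree.of_hasPeriod (n := w.length) (by rw [← hi]; exact hP))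
  have h1 := hP.1
  rw [exponent, div_le_iff₀ (by exact_mod_cast h1)]
  have : 2 * w.length ≤ 5 * minPeriod w := by omega
  have : (2 : ℚ) * w.length ≤ 5 * minPeriod w := by exact_mod_cast this
  linarith

theorem exponent_eq : exponent ([1, 0, 0, 1, 1, 0, 0, 1, 1, 0] : List (Fin 2)) = 5 / 2 := by
  have : minPeriod ([1, 0, 0, 1, 1, 0, 0, 1, 1, 0] : List (Fin 2)) = 4 := by
    refine le_antisymm (Nat.sInf_le ⟨by decide, by decide, fun j hj => ?_⟩) ?_
    · replace hj : j < 6 := by simp only [List.length_cons, List.length_nil] at hj; omega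
      interval_cases j <;> rfl
    · have h := minPeriod_mem (w := ([1, 0, 0, 1, 1, 0, 0, 1, 1, 0] : List (Fin 2))) (by simp)
      by_contra hlt
      generalize minPeriod ([1, 0, 0, 1, 1, 0, 0, 1, 1, 0] : List (Fin 2)) = P at h hlt
      obtain ⟨h1, -, h⟩ := h
      have h0 := h 0
      have h2 := h 1
      interval_cases P <;> simp_all
  rw [exponent, this]
  norm_num

/-- The word `q = g(p)` has factor complexity `2n` and critical exponent `5/2`,
attained by some factor. -/
theorem stmt2 (p : ℕ → Fin 3) (hp0 : p 0 = 0) (hpfix : applyMorph hm p = p) :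
    (∀ n, 1 ≤ n → complexity (applyMorph gm p) n = 2 * n) ∧
    criticalExponent (applyMorph gm p) = 5 / 2 ∧
    ∃ w : List (Fin 2), IsFactor (applyMorph gm p) w ∧ w ≠ [] ∧ exponent w = 5 / 2 := by
  have hH := isHBlock hp0 hpfix
  have hG := isGBlock p
  have hw : IsFactor (applyMorph gm p) [1, 0, 0, 1, 1, 0, 0, 1, 1, 0] :=
    ⟨11, (hG.factorAt_eleven hH).symm⟩
  have h52 : ENNReal.ofReal (((5 / 2 : ℚ)) : ℝ) = 5 / 2 := by
    push_cast
    rw [ENNReal.ofReal_div_of_pos (by norm_num)]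
    norm_num
  refine ⟨hG.complexity_eq hH, le_antisymm (sSup_le ?_) (le_sSup ?_), _, hw, by simp, exponent_eq⟩
  · rintro _ ⟨w, hf, hne, rfl⟩
    rw [← h52]
    refine ENNReal.ofReal_le_ofReal (Rat.cast_le.2 ?_)
    exact exponent_le (fun _ _ _ => hG.two_mul_le_three_mul hH) hf hne
  · exact ⟨_, hw, by simp, by rw [exponent_eq, h52]⟩
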